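/- arXiv:1706.09136 — 2 statements merged into one kernel-verified Lean document; each statement's English description precedes it below -/
import Mathlib

section
/- For every prime p > 5, in (ZMod p)[t] one has £^{OY}_{(1,1,1,1)}(t) = (1/24) £_1(t)^4 + (1/3) Z(1,2) \cdot t^p (1-t)^p \cdot £_1(t), where Z(1,2) := \sum_{0<n_1<n_2<p} n_1^{-1} n_2^{-2}. -/
open Polynomial Finset

/-- £₁(t). -/
noncomputable def L1 (p : ℕ) : Polynomial (ZMod p) :=
  ∑ l ∈ Ico 1 p, C ((l : ZMod p)⁻¹) * X ^ l

/-- £^OY_{(1,1,1,1)} with tˢ replaced by uˢ. -/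
noncomputable def OY1111 (p : ℕ) (u : Polynomial (ZMod p)) : Polynomial (ZMod p) :=
  ∑ l1 ∈ Ico 1 p, ∑ l2 ∈ Ico 1 p, ∑ l3 ∈ Ico 1 p, ∑ l4 ∈ Ico 1 p,
    if ¬ p ∣ l1 ∧ ¬ p ∣ (l1 + l2) ∧ ¬ p ∣ (l1 + l2 + l3) ∧ ¬ p ∣ (l1 + l2 + l3 + l4) then
      C ((l1 : ZMod p)⁻¹ * ((l1 + l2 : ℕ) : ZMod p)⁻¹ * ((l1 + l2 + l3 : ℕ) : ZMod p)⁻¹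
          * ((l1 + l2 + l3 + l4 : ℕ) : ZMod p)⁻¹) * u ^ (l1 + l2 + l3 + l4)
    else 0

/-- ζ(1,2) mod p. -/
def Z12 (p : ℕ) : ZMod p :=
  ∑ n2 ∈ Ico 1 p, ∑ n1 ∈ Ico 1 n2, (n1 : ZMod p)⁻¹ * ((n2 : ZMod p)⁻¹) ^ 2


namespace OYaux

variable {p : ℕ} [hpf : Fact p.Prime]

noncomputable def G (p : ℕ) : Polynomial (ZMod p) := ∑ l ∈ Ico 1 p, X ^ l

noncomputable def th (f : Polynomial (ZMod p)) : Polynomial (ZMod p) := X * derivative f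

noncomputable def I (p : ℕ) [Fact p.Prime] : Polynomial (ZMod p) →ₗ[ZMod p] Polynomial (ZMod p) :=
  Polynomial.lsum (fun n => ((n : ZMod p)⁻¹) • monomial n)

def h1 (p : ℕ) (n : ℕ) : ZMod p := ∑ m ∈ range n, (m : ZMod p)⁻¹
def h2 (p : ℕ) (n : ℕ) : ZMod p := ∑ m ∈ range n, ((m : ZMod p)⁻¹) ^ 2

lemma I_monomial (n : ℕ) (c : ZMod p) : I p (monomial n c) = monomial n ((n : ZMod p)⁻¹ * c) := by
  simp [I, Polynomial.lsum_apply, Polynomial.sum_monomial_index, smul_monomial]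

lemma I_CX (n : ℕ) (c : ZMod p) : I p (C c * X ^ n) = C (c * (n : ZMod p)⁻¹) * X ^ n := by
  rw [C_mul_X_pow_eq_monomial, I_monomial, C_mul_X_pow_eq_monomial, mul_comm]

lemma coeff_I (f : Polynomial (ZMod p)) (n : ℕ) :
    (I p f).coeff n = (n : ZMod p)⁻¹ * f.coeff n := by
  induction f using Polynomial.induction_on' with
  | add f g hf hg => simp [hf, hg, mul_add]
  | monomial k c =>
    rw [I_monomial, coeff_monomial, coeff_monomial]
    split_ifs with h
    · rw [h]
    · simp

lemma coeff_th (f : Polynomial (ZMod p)) (n : ℕ) : (th f).coeff n = n * f.coeff n := by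
  cases n with
  | zero => simp [th]
  | succ n => simp [th, coeff_derivative, mul_comm]

lemma I_th (f : Polynomial (ZMod p)) (hf : ∀ k, f.coeff (k * p) = 0) : I p (th f) = f := by
  ext n
  rw [coeff_I, coeff_th]
  by_cases h : (n : ZMod p) = 0
  · obtain ⟨k, rfl⟩ := (ZMod.natCast_eq_zero_iff n p).1 h
    rw [mul_comm p k, hf]; simp
  · field_simp

lemma coeff_L1 (n : ℕ) : (L1 p).coeff n = if n < p then (n : ZMod p)⁻¹ else 0 := by
  simp only [L1, finsetSum_coeff, coeff_C_mul, coeff_X_pow]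
  simp only [mul_ite, mul_one, mul_zero, Finset.sum_ite_eq, mem_Ico]
  rcases Nat.eq_zero_or_pos n with rfl | h
  · simp
  · simp [Nat.succ_le_iff, h]

lemma coeff_L1' {n : ℕ} (h : n ≤ p) : (L1 p).coeff n = (n : ZMod p)⁻¹ := by
  rw [coeff_L1]
  split_ifs with h'
  · rfl
  · obtain rfl : n = p := by omega
    simp

lemma natDegree_L1 : (L1 p).natDegree ≤ p - 1 := by
  rw [natDegree_le_iff_coeff_eq_zero]
  intro n hn
  rw [coeff_L1, if_neg (by omega)]

lemma th_L1 : th (L1 p) = G p := by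
  ext n
  rw [coeff_th, coeff_L1]
  simp only [G, finsetSum_coeff, coeff_X_pow, Finset.sum_ite_eq, mem_Ico]
  rcases Nat.eq_zero_or_pos n with rfl | h
  · simp
  · by_cases h' : n < p
    · have : (n : ZMod p) ≠ 0 := by
        rw [Ne, ZMod.natCast_eq_zero_iff]
        exact Nat.not_dvd_of_pos_of_lt h h'
      rw [if_pos h', if_pos ⟨h, h'⟩, mul_inv_cancel₀ this]
    · simp [h']

lemma th_pow (k : ℕ) : th ((L1 p) ^ (k + 1)) = ((k + 1 : ℕ) : Polynomial (ZMod p)) * (L1 p) ^ k * G p := by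
  rw [← th_L1]
  simp only [th, derivative_pow]
  simp
  ring

lemma coeff_mul_G (q : Polynomial (ZMod p)) (hq : q.coeff 0 = 0) {n : ℕ} (hn : n ≤ p) :
    (q * G p).coeff n = ∑ m ∈ range n, q.coeff m := by
  rw [coeff_mul, Finset.Nat.sum_antidiagonal_eq_sum_range_succ (fun i j => q.coeff i * (G p).coeff j),
    sum_range_succ]
  have h0 : (G p).coeff 0 = 0 := by
    simp [G, finsetSum_coeff, coeff_X_pow]
  rw [Nat.sub_self, h0, mul_zero, add_zero]
  apply sum_congr rfl
  intro m hm
  rw [mem_range] at hm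
  rcases Nat.eq_zero_or_pos m with rfl | h
  · simp [hq]
  · have : (G p).coeff (n - m) = 1 := by
      simp only [G, finsetSum_coeff, coeff_X_pow, Finset.sum_ite_eq, mem_Ico]
      rw [if_pos (by omega)]
    rw [this, mul_one]

lemma coeff_mul' (f g : Polynomial (ZMod p)) (n : ℕ) :
    (f * g).coeff n = ∑ m ∈ range (n + 1), f.coeff m * g.coeff (n - m) := by
  rw [coeff_mul, Finset.Nat.sum_antidiagonal_eq_sum_range_succ (fun i j => f.coeff i * g.coeff j)]

lemma coeff_pow_zero (k : ℕ) : ((L1 p) ^ (k + 1)).coeff 0 = 0 := by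
  rw [coeff_zero_eq_eval_zero, eval_pow, ← coeff_zero_eq_eval_zero, coeff_L1' (Nat.zero_le _)]
  simp

lemma reflect_L1 : reflect p (L1 p) = - L1 p := by
  ext n
  rw [coeff_reflect, coeff_neg]
  by_cases h : n ≤ p
  · rw [revAt_le h, coeff_L1' h, coeff_L1' (Nat.sub_le _ _), Nat.cast_sub h, CharP.cast_eq_zero, zero_sub, inv_neg]
  · rw [revAt_eq_self_of_lt (by omega), coeff_L1, if_neg (by omega)]
    simp

lemma natDegree_L1_pow (k : ℕ) : ((L1 p) ^ k).natDegree ≤ k * (p - 1) :=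
  natDegree_pow_le_of_le k natDegree_L1

lemma natDegree_L1_pow' (k : ℕ) : ((L1 p) ^ k).natDegree ≤ k * p :=
  (natDegree_L1_pow k).trans (Nat.mul_le_mul_left _ (Nat.sub_le _ _))

lemma reflect_L1_pow (k : ℕ) : reflect (k * p) ((L1 p) ^ k) = (- L1 p) ^ k := by
  induction k with
  | zero => simp
  | succ k ih =>
    rw [pow_succ, add_mul, one_mul, reflect_mul _ _ (natDegree_L1_pow' k)
      (natDegree_L1.trans (Nat.sub_le _ _)), ih, reflect_L1, pow_succ]

lemma coeff_reflect_pow (k : ℕ) {n : ℕ} (hn : n ≤ k * p) :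
    ((L1 p) ^ k).coeff (k * p - n) = (-1) ^ k * ((L1 p) ^ k).coeff n := by
  rw [← revAt_le hn, ← coeff_reflect, reflect_L1_pow, neg_pow, ← C_1, ← C_neg, ← C_pow, coeff_C_mul]

lemma inv_sub' {n : ℕ} (h : n ≤ p) : (((p - n : ℕ) : ZMod p))⁻¹ = - (n : ZMod p)⁻¹ := by
  rw [Nat.cast_sub h, CharP.cast_eq_zero, zero_sub, inv_neg]

lemma natCast_ne {n : ℕ} (h0 : 0 < n) (h : n < p) : (n : ZMod p) ≠ 0 := by
  rw [Ne, ZMod.natCast_eq_zero_iff]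
  exact Nat.not_dvd_of_pos_of_lt h0 h

/-- power sums vanish -/
lemma psum (k : ℕ) (hk0 : 0 < k) (hk : k < p - 1) :
    ∑ n ∈ range p, ((n : ZMod p)⁻¹) ^ k = 0 := by
  have h1 : ∑ n ∈ range p, ((n : ZMod p)⁻¹) ^ k = ∑ x : ZMod p, (x⁻¹) ^ k := by
    refine Finset.sum_bij (fun n _ => (n : ZMod p)) (by simp) ?_ ?_ (by simp)
    · intro a ha b hb hab
      rw [mem_range] at ha hb
      rw [ZMod.natCast_eq_natCast_iff'] at hab
      rwa [Nat.mod_eq_of_lt ha, Nat.mod_eq_of_lt hb] at hab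
    · intro b _
      exact ⟨b.val, by simpa using ZMod.val_lt b, by simp⟩
  rw [h1]
  have h2 : ∑ x : ZMod p, (x⁻¹) ^ k = ∑ x : ZMod p, x ^ k :=
    Equiv.sum_comp (Equiv.inv (ZMod p)) (fun x => x ^ k)
  rw [h2]
  exact FiniteField.sum_pow_lt_card_sub_one (ZMod p) k (by rwa [ZMod.card])

lemma psum' (k : ℕ) (hk0 : 0 < k) (hk : k < p - 1) :
    ∑ n ∈ range (p + 1), ((n : ZMod p)⁻¹) ^ k = 0 := by
  rw [sum_range_succ, psum k hk0 hk]
  simp [hk0.ne']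

lemma h1_refl (h5 : 5 < p) {n : ℕ} (hn : n < p) : h1 p (p - n) = h1 p n + (n : ZMod p)⁻¹ := by
  have key : ∀ n, n < p → h1 p (p - n) = h1 p (n + 1) := by
    intro n
    induction n with
    | zero =>
      intro _
      have := psum (p := p) 1 (by omega) (by omega)
      simpa [h1] using this
    | succ n ih =>
      intro hn
      have e := ih (by omega)
      rw [show p - n = (p - (n + 1)) + 1 by omega] at e
      have e1 : h1 p ((p - (n + 1)) + 1) = h1 p (p - (n + 1)) + ((p - (n + 1) : ℕ) : ZMod p)⁻¹ := by
        rw [h1, h1, sum_range_succ]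
      have e2 : h1 p (n + 1 + 1) = h1 p (n + 1) + ((n + 1 : ℕ) : ZMod p)⁻¹ := by
        rw [h1, h1, sum_range_succ]
      rw [e1, inv_sub' (by omega)] at e
      rw [e2, ← e]; ring
  rw [key n hn, h1, h1, sum_range_succ]

lemma h2_refl (h5 : 5 < p) {n : ℕ} (hn : n < p) :
    h2 p (p - n) = - h2 p n - ((n : ZMod p)⁻¹) ^ 2 := by
  have key : ∀ n, n < p → h2 p (p - n) = - h2 p (n + 1) := by
    intro n
    induction n with
    | zero =>
      intro _
      have := psum (p := p) 2 (by omega) (by omega)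
      simpa [h2] using this
    | succ n ih =>
      intro hn
      have e := ih (by omega)
      rw [show p - n = (p - (n + 1)) + 1 by omega] at e
      have e1 : h2 p ((p - (n + 1)) + 1)
          = h2 p (p - (n + 1)) + (((p - (n + 1) : ℕ) : ZMod p)⁻¹) ^ 2 := by
        rw [h2, h2, sum_range_succ]
      have e2 : h2 p (n + 1 + 1) = h2 p (n + 1) + (((n + 1 : ℕ) : ZMod p)⁻¹) ^ 2 := by
        rw [h2, h2, sum_range_succ]
      rw [e1, inv_sub' (by omega)] at e
      rw [e2]
      linear_combination e
  rw [key n hn, h2, h2, sum_range_succ]; ring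

lemma small_ne (h5 : 5 < p) {n : ℕ} (h0 : 0 < n) (h : n < 6) : (n : ZMod p) ≠ 0 :=
  natCast_ne h0 (by omega)

lemma Tzero (h5 : 5 < p) : ∑ n ∈ range (p + 1), h1 p n * ((n : ZMod p)⁻¹) ^ 3 = 0 := by
  have h := Finset.sum_flip (n := p) (fun n => h1 p n * ((n : ZMod p)⁻¹) ^ 3)
  have e : ∑ n ∈ range (p + 1), h1 p (p - n) * (((p - n : ℕ) : ZMod p)⁻¹) ^ 3
      = ∑ n ∈ range (p + 1), (- (h1 p n * ((n : ZMod p)⁻¹) ^ 3) - ((n : ZMod p)⁻¹) ^ 4) := by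
    apply sum_congr rfl
    intro n hn
    rw [mem_range] at hn
    rw [inv_sub' (by omega)]
    by_cases hnp : n = p
    · subst hnp; simp
    · rw [h1_refl h5 (by omega)]; ring
  rw [e, sum_sub_distrib, sum_neg_distrib, psum' 4 (by omega) (by omega)] at h
  have h2 : ((2 : ℕ) : ZMod p) ≠ 0 := small_ne h5 (by omega) (by omega)
  refine (mul_eq_zero.1 (?_ : ((2 : ℕ) : ZMod p) * _ = 0)).resolve_left h2
  push_cast
  linear_combination -h

lemma Z22zero (h5 : 5 < p) : ∑ n ∈ range (p + 1), h2 p n * ((n : ZMod p)⁻¹) ^ 2 = 0 := by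
  have h := Finset.sum_flip (n := p) (fun n => h2 p n * ((n : ZMod p)⁻¹) ^ 2)
  have e : ∑ n ∈ range (p + 1), h2 p (p - n) * (((p - n : ℕ) : ZMod p)⁻¹) ^ 2
      = ∑ n ∈ range (p + 1), (- (h2 p n * ((n : ZMod p)⁻¹) ^ 2) - ((n : ZMod p)⁻¹) ^ 4) := by
    apply sum_congr rfl
    intro n hn
    rw [mem_range] at hn
    rw [inv_sub' (by omega)]
    by_cases hnp : n = p
    · subst hnp; simp
    · rw [h2_refl h5 (by omega)]; ring
  rw [e, sum_sub_distrib, sum_neg_distrib, psum' 4 (by omega) (by omega)] at h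
  have h2 : ((2 : ℕ) : ZMod p) ≠ 0 := small_ne h5 (by omega) (by omega)
  refine (mul_eq_zero.1 (?_ : ((2 : ℕ) : ZMod p) * _ = 0)).resolve_left h2
  push_cast
  linear_combination -h

lemma coeff_pow_succ (k : ℕ) {n : ℕ} (hn : n < p) :
    ((L1 p) ^ (k + 2)).coeff n
      = (k + 2) * (n : ZMod p)⁻¹ * ∑ m ∈ range n, ((L1 p) ^ (k + 1)).coeff m := by
  rcases Nat.eq_zero_or_pos n with rfl | h0
  · rw [coeff_pow_zero]; simp
  have hne := natCast_ne h0 hn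
  have h := coeff_th ((L1 p) ^ (k + 2)) n
  rw [th_pow (k + 1), mul_assoc, ← C_eq_natCast, coeff_C_mul,
    coeff_mul_G _ (coeff_pow_zero k) hn.le] at h
  push_cast at h
  field_simp
  linear_combination -h

lemma coeff_sq_p (h5 : 5 < p) : ((L1 p) ^ 2).coeff p = 0 := by
  rw [pow_two, coeff_mul']
  have : ∀ m ∈ range (p + 1), (L1 p).coeff m * (L1 p).coeff (p - m) = - ((m : ZMod p)⁻¹) ^ 2 := by
    intro m hm
    rw [mem_range] at hm
    rw [coeff_L1' (by omega), coeff_L1' (by omega), inv_sub' (by omega)]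
    ring
  rw [sum_congr rfl this, sum_neg_distrib, psum' 2 (by omega) (by omega), neg_zero]

lemma coeff_sq (h5 : 5 < p) {n : ℕ} (hn : n ≤ p) :
    ((L1 p) ^ 2).coeff n = 2 * h1 p n * (n : ZMod p)⁻¹ := by
  by_cases h : n = p
  · subst h; rw [coeff_sq_p h5]; simp
  have := coeff_pow_succ 0 (show n < p by omega)
  rw [this, h1]
  have e : ∀ m ∈ range n, ((L1 p) ^ (0 + 1)).coeff m = (m : ZMod p)⁻¹ := by
    intro m hm
    rw [mem_range] at hm
    rw [zero_add, pow_one, coeff_L1' (by omega)]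
  rw [sum_congr rfl e]
  push_cast; ring

lemma h1_sq (n : ℕ) : ∑ m ∈ range n, 2 * h1 p m * (m : ZMod p)⁻¹ = h1 p n ^ 2 - h2 p n := by
  induction n with
  | zero => simp [h1, h2]
  | succ n ih =>
    have e1 : h1 p (n + 1) = h1 p n + (n : ZMod p)⁻¹ := by
      rw [h1, h1, sum_range_succ]
    have e2 : h2 p (n + 1) = h2 p n + ((n : ZMod p)⁻¹) ^ 2 := by
      rw [h2, h2, sum_range_succ]
    rw [sum_range_succ, ih, e1, e2]; ring

lemma coeff_cube (h5 : 5 < p) {n : ℕ} (hn : n < p) :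
    ((L1 p) ^ 3).coeff n = 3 * (n : ZMod p)⁻¹ * (h1 p n ^ 2 - h2 p n) := by
  rw [coeff_pow_succ 1 hn, ← h1_sq]
  have e : ∀ m ∈ range n, ((L1 p) ^ (1 + 1)).coeff m = 2 * h1 p m * (m : ZMod p)⁻¹ := by
    intro m hm
    rw [mem_range] at hm
    exact coeff_sq h5 (by omega)
  rw [sum_congr rfl e]
  push_cast; ring

lemma Z12_eq : Z12 p = ∑ n ∈ range (p + 1), h1 p n * ((n : ZMod p)⁻¹) ^ 2 := by
  have hp1 : 0 < p := hpf.out.pos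
  rw [Z12, sum_range_succ, range_eq_Ico, sum_eq_sum_Ico_succ_bot hp1]
  have z : h1 p 0 = 0 := by simp [h1]
  rw [z, zero_mul, zero_add, CharP.cast_eq_zero, inv_zero, zero_pow two_ne_zero, mul_zero, add_zero]
  apply sum_congr rfl
  intro n hn
  rw [mem_Ico] at hn
  rw [← sum_mul, h1, range_eq_Ico, sum_eq_sum_Ico_succ_bot (show 0 < n by omega)]
  simp

lemma coeff_cube_p (h5 : 5 < p) : ((L1 p) ^ 3).coeff p = - 2 * Z12 p := by
  rw [pow_succ, coeff_mul', Z12_eq, mul_sum]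
  apply sum_congr rfl
  intro m hm
  rw [mem_range] at hm
  rw [coeff_sq h5 (by omega), coeff_L1' (by omega), inv_sub' (by omega)]
  ring

lemma coeff_cube_two_p (h5 : 5 < p) : ((L1 p) ^ 3).coeff (2 * p) = 2 * Z12 p := by
  have := coeff_reflect_pow (p := p) 3 (n := p) (by omega)
  rw [show 3 * p - p = 2 * p by omega, coeff_cube_p h5] at this
  rw [this]; ring

lemma four_a (h5 : 5 < p) : ((L1 p) ^ 4).coeff p
    = -4 * ∑ n ∈ range (p + 1), h1 p n ^ 2 * ((n : ZMod p)⁻¹) ^ 2 := by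
  have T := Tzero h5
  rw [show 4 = 2 + 2 from rfl, pow_add, coeff_mul']
  have e : ∀ m ∈ range (p + 1), ((L1 p) ^ 2).coeff m * ((L1 p) ^ 2).coeff (p - m)
      = -4 * (h1 p m ^ 2 * ((m : ZMod p)⁻¹) ^ 2) - 4 * (h1 p m * ((m : ZMod p)⁻¹) ^ 3) := by
    intro m hm
    rw [mem_range] at hm
    rw [coeff_sq h5 (by omega), coeff_sq h5 (by omega), inv_sub' (by omega)]
    by_cases hmp : m = p
    · subst hmp; simp
    · rw [h1_refl h5 (by omega)]; ring
  rw [sum_congr rfl e, sum_sub_distrib, ← mul_sum, ← mul_sum, T]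
  ring

lemma four_b (h5 : 5 < p) : ((L1 p) ^ 4).coeff p
    = -3 * ∑ n ∈ range (p + 1), h1 p n ^ 2 * ((n : ZMod p)⁻¹) ^ 2 := by
  have T := Z22zero h5
  rw [show 4 = 3 + 1 from rfl, pow_succ, coeff_mul']
  have e : ∀ m ∈ range (p + 1), ((L1 p) ^ 3).coeff m * (L1 p).coeff (p - m)
      = -3 * (h1 p m ^ 2 * ((m : ZMod p)⁻¹) ^ 2) + 3 * (h2 p m * ((m : ZMod p)⁻¹) ^ 2) := by
    intro m hm
    rw [mem_range] at hm
    rw [coeff_L1' (Nat.sub_le _ _), inv_sub' (by omega)]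
    by_cases hmp : m = p
    · subst hmp; simp
    · rw [coeff_cube h5 (by omega)]; ring
  rw [sum_congr rfl e, sum_add_distrib, ← mul_sum, ← mul_sum, T]
  ring

lemma Szero (h5 : 5 < p) : ∑ n ∈ range (p + 1), h1 p n ^ 2 * ((n : ZMod p)⁻¹) ^ 2 = 0 := by
  linear_combination four_a h5 - four_b h5

lemma four_p (h5 : 5 < p) : ((L1 p) ^ 4).coeff p = 0 := by
  rw [four_a h5, Szero h5, mul_zero]

lemma four_three_p (h5 : 5 < p) : ((L1 p) ^ 4).coeff (3 * p) = 0 := by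
  have := coeff_reflect_pow (p := p) 4 (n := p) (by omega)
  rw [show 4 * p - p = 3 * p by omega, four_p h5, mul_zero] at this
  exact this

lemma four_two_p (h5 : 5 < p) : ((L1 p) ^ 4).coeff (2 * p) = 0 := by
  rw [show 4 = 2 + 2 from rfl, pow_add, coeff_mul']
  have e : ∀ m ∈ range (2 * p + 1), ((L1 p) ^ 2).coeff m * ((L1 p) ^ 2).coeff (2 * p - m)
      = ((L1 p) ^ 2).coeff m ^ 2 := by
    intro m hm
    rw [mem_range] at hm
    rw [coeff_reflect_pow 2 (by omega)]
    ring
  rw [sum_congr rfl e]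
  have lo : ∑ m ∈ range (p + 1), ((L1 p) ^ 2).coeff m ^ 2 = 0 := by
    have e : ∀ m ∈ range (p + 1), ((L1 p) ^ 2).coeff m ^ 2
        = 4 * (h1 p m ^ 2 * ((m : ZMod p)⁻¹) ^ 2) := by
      intro m hm
      rw [mem_range] at hm
      rw [coeff_sq h5 (by omega)]; ring
    rw [sum_congr rfl e, ← mul_sum, Szero h5, mul_zero]
  rw [show 2 * p + 1 = p + (p + 1) by omega, sum_range_add]
  have lo' := lo
  rw [sum_range_succ, coeff_sq_p h5] at lo'
  have hi : ∑ m ∈ range (p + 1), ((L1 p) ^ 2).coeff (p + m) ^ 2 = 0 := by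
    rw [← lo, ← Finset.sum_flip]
    apply sum_congr rfl
    intro m hm
    rw [mem_range] at hm
    have := coeff_reflect_pow (p := p) 2 (n := m) (by omega)
    rw [show p + (p - m) = 2 * p - m by omega, this]
    ring
  rw [hi]
  linear_combination lo'

lemma coeff_big (j k : ℕ) (hj : 0 < j) (hk : j ≤ k) : ((L1 p) ^ j).coeff (k * p) = 0 := by
  apply coeff_eq_zero_of_natDegree_lt
  refine (natDegree_L1_pow j).trans_lt ?_
  have hp1 : 0 < p := hpf.out.pos
  calc j * (p - 1) < j * p := Nat.mul_lt_mul_of_pos_left (by omega) hj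
    _ ≤ k * p := Nat.mul_le_mul_right _ hk

lemma step1 : I p (G p) = L1 p := by
  rw [← th_L1]
  apply I_th
  intro k
  rcases Nat.eq_zero_or_pos k with rfl | hk
  · simpa using coeff_pow_zero (p := p) 0
  · simpa using coeff_big (p := p) 1 k (by omega) hk

lemma th_C_mul (c : ZMod p) (f : Polynomial (ZMod p)) : th (C c * f) = C c * th f := by
  simp [th]; ring

lemma step2 (h5 : 5 < p) : I p (L1 p * G p) = C ((2 : ZMod p)⁻¹) * L1 p ^ 2 := by
  have h2 : (2 : ZMod p) ≠ 0 := by exact_mod_cast small_ne h5 (n := 2) (by omega) (by omega)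
  have : L1 p * G p = th (C ((2 : ZMod p)⁻¹) * L1 p ^ 2) := by
    rw [th_C_mul, th_pow 1]
    have : C ((2 : ZMod p)⁻¹) * C 2 = 1 := by rw [← C_mul, inv_mul_cancel₀ h2, C_1]
    rw [← C_eq_natCast]
    push_cast
    linear_combination -(L1 p * G p) * this
  rw [this]
  apply I_th
  intro k
  rw [coeff_C_mul]
  rcases k with _ | _ | k
  · rw [zero_mul, coeff_pow_zero 1, mul_zero]
  · rw [zero_add, one_mul, coeff_sq_p h5, mul_zero]
  · rw [coeff_big 2 _ (by omega) (by omega), mul_zero]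

/-- the correction factor -/
noncomputable def W (p : ℕ) : Polynomial (ZMod p) := C ((3 : ZMod p)⁻¹ * Z12 p) * (X ^ p - X ^ (2 * p))

lemma derivative_W : derivative (W p) = 0 := by
  simp only [W, derivative_C_mul, derivative_sub, derivative_X_pow]
  simp

lemma th_W_mul (f : Polynomial (ZMod p)) : th (W p * f) = W p * th f := by
  have h := derivative_W (p := p)
  simp only [th, derivative_mul, h]; ring

lemma th_W : th (W p) = 0 := by
  rw [th, derivative_W, mul_zero]

lemma th_add (f g : Polynomial (ZMod p)) : th (f + g) = th f + th g := by
  simp [th]; ring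

lemma coeff_W (k : ℕ) : (W p).coeff (k * p)
    = ((3 : ZMod p)⁻¹ * Z12 p) * ((if k = 1 then 1 else 0) - (if k = 2 then 1 else 0)) := by
  have hp1 : p ≠ 0 := hpf.out.ne_zero
  have h1 : (k * p = p) = (k = 1) := by
    have := Nat.mul_left_inj hp1 (b := k) (c := 1)
    rw [one_mul] at this
    exact propext this
  have h2 : (k * p = 2 * p) = (k = 2) :=
    propext (Nat.mul_left_inj hp1)
  simp only [W, coeff_C_mul, coeff_sub, coeff_X_pow, h1, h2]

lemma step3 (h5 : 5 < p) :
    I p (C ((2 : ZMod p)⁻¹) * L1 p ^ 2 * G p) = C ((6 : ZMod p)⁻¹) * L1 p ^ 3 + W p := by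
  have h2 : (2 : ZMod p) ≠ 0 := by exact_mod_cast small_ne h5 (n := 2) (by omega) (by omega)
  have h3 : (3 : ZMod p) ≠ 0 := by exact_mod_cast small_ne h5 (n := 3) (by omega) (by omega)
  have h6 : (6 : ZMod p)⁻¹ = 2⁻¹ * 3⁻¹ := by
    rw [← mul_inv]; norm_num
  have : C ((2 : ZMod p)⁻¹) * L1 p ^ 2 * G p = th (C ((6 : ZMod p)⁻¹) * L1 p ^ 3 + W p) := by
    rw [th_add, th_W, th_C_mul, th_pow 2, h6, C_mul]
    have : C ((3 : ZMod p)⁻¹) * C 3 = 1 := by rw [← C_mul, inv_mul_cancel₀ h3, C_1]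
    rw [← C_eq_natCast, show (((2 + 1 : ℕ)) : ZMod p) = 3 by norm_num]
    linear_combination -(C ((2 : ZMod p)⁻¹) * L1 p ^ 2 * G p) * this
  rw [this]
  apply I_th
  intro k
  rw [coeff_add, coeff_C_mul, coeff_W, h6]
  rcases k with _ | _ | _ | k
  · rw [zero_mul, coeff_pow_zero 2]; simp
  · rw [zero_add, one_mul, coeff_cube_p h5]
    simp; field_simp; ring
  · rw [zero_add, one_add_one_eq_two, coeff_cube_two_p h5]
    simp; field_simp; ring
  · rw [coeff_big 3 _ (by omega) (by omega)]; simp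

lemma coeff_WL (k : ℕ) : (W p * L1 p).coeff (k * p) = 0 := by
  have hL : ∀ j, (L1 p).coeff (j * p) = 0 := by
    intro j
    rcases Nat.eq_zero_or_pos j with rfl | hj
    · simpa using coeff_pow_zero (p := p) 0
    · simpa using coeff_big (p := p) 1 j (by omega) hj
  rw [W, mul_assoc, coeff_C_mul, sub_mul, coeff_sub, coeff_X_pow_mul', coeff_X_pow_mul',
    ← Nat.sub_mul, ← Nat.sub_one_mul, hL, hL]
  simp

lemma step4 (h5 : 5 < p) :
    I p ((C ((6 : ZMod p)⁻¹) * L1 p ^ 3 + W p) * G p)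
      = C ((24 : ZMod p)⁻¹) * L1 p ^ 4 + W p * L1 p := by
  have h4 : (4 : ZMod p) ≠ 0 := by exact_mod_cast small_ne h5 (n := 4) (by omega) (by omega)
  have h24 : (24 : ZMod p)⁻¹ = 6⁻¹ * 4⁻¹ := by
    rw [← mul_inv]; norm_num
  have : (C ((6 : ZMod p)⁻¹) * L1 p ^ 3 + W p) * G p
      = th (C ((24 : ZMod p)⁻¹) * L1 p ^ 4 + W p * L1 p) := by
    rw [th_add, th_W_mul, th_L1, th_C_mul, th_pow 3, h24, C_mul]
    have : C ((4 : ZMod p)⁻¹) * C 4 = 1 := by rw [← C_mul, inv_mul_cancel₀ h4, C_1]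
    rw [← C_eq_natCast, show (((3 + 1 : ℕ)) : ZMod p) = 4 by norm_num]
    linear_combination -(C ((6 : ZMod p)⁻¹) * L1 p ^ 3 * G p) * this
  rw [this]
  apply I_th
  intro k
  rw [coeff_add, coeff_C_mul, coeff_WL, add_zero]
  rcases k with _ | _ | _ | _ | k
  · rw [zero_mul, coeff_pow_zero 3, mul_zero]
  · rw [zero_add, one_mul, four_p h5, mul_zero]
  · rw [zero_add, one_add_one_eq_two, four_two_p h5, mul_zero]
  · rw [zero_add, show 1 + 1 + 1 = 3 from rfl, four_three_p h5, mul_zero]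
  · rw [coeff_big 4 _ (by omega) (by omega), mul_zero]

lemma I_CX_G (n : ℕ) (c : ZMod p) : I p (C c * X ^ n * G p)
    = ∑ l ∈ Ico 1 p, C (c * ((n + l : ℕ) : ZMod p)⁻¹) * X ^ (n + l) := by
  rw [G, mul_sum, map_sum]
  apply sum_congr rfl
  intro l _
  rw [mul_assoc, ← pow_add, I_CX]

lemma OY_eq : OY1111 p X = I p (I p (I p (I p (G p) * G p) * G p) * G p) := by
  rw [step1, L1]
  simp only [sum_mul, map_sum, I_CX_G]
  unfold OY1111
  refine sum_congr rfl fun l1 _ => sum_congr rfl fun l2 _ => sum_congr rfl fun l3 _ =>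
    sum_congr rfl fun l4 _ => ?_
  split_ifs with h
  · rfl
  · have h0 : ∀ n : ℕ, p ∣ n → (n : ZMod p)⁻¹ = 0 := by
      intro n hn
      rw [(ZMod.natCast_eq_zero_iff n p).2 hn, inv_zero]
    rw [not_and_or, not_and_or, not_and_or, not_not, not_not, not_not, not_not] at h
    rcases h with h | h | h | h <;> rw [h0 _ h] <;> simp

end OYaux

theorem OY1111_formula (p : ℕ) (hp : p.Prime) (h5 : 5 < p) :
    OY1111 p X = C ((24 : ZMod p)⁻¹) * (L1 p) ^ 4
      + C ((3 : ZMod p)⁻¹ * Z12 p) * X ^ p * (1 - X) ^ p * L1 p := by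
  have : Fact p.Prime := ⟨hp⟩
  rw [OYaux.OY_eq, OYaux.step1, OYaux.step2 h5, OYaux.step3 h5, OYaux.step4 h5, OYaux.W]
  have : (1 - X : Polynomial (ZMod p)) ^ p = 1 - X ^ p := by
    rw [sub_pow_char, one_pow]
  rw [this]
  ring
end

section
/- For every prime p > 5, ζ(1,1,1,2) \equiv B_{p-5} \pmod p, where ζ(1,1,1,2) := \sum_{0<n_1<n_2<n_3<n_4<p} (n_1 n_2 n_3)^{-1} n_4^{-2} in ZMod p and B_{p-5} is the (p-5)-th Bernoulli number (p-integral by von Staudt–Clausen). -/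
open Finset

/-- Reduction mod p of the rational Bernoulli number Bₙ. -/
noncomputable def bernoulliBar (p n : ℕ) : ZMod p :=
  ((bernoulli n).num : ZMod p) * (((bernoulli n).den : ℕ) : ZMod p)⁻¹

/-- `q` is p-integral and reduces to `z`. -/
def RedTo (p : ℕ) [Fact p.Prime] (q : ℚ) (z : ZMod p) : Prop :=
  ((q.den : ZMod p) ≠ 0) ∧ (q : ZMod p) = z

section red
variable {p : ℕ} [Fact p.Prime]

lemma RedTo.add {q r : ℚ} {y z : ZMod p} (h : RedTo p q y) (h' : RedTo p r z) :
    RedTo p (q + r) (y + z) := by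
  refine ⟨?_, ?_⟩
  · intro h0
    have hd : ((q.den * r.den : ℕ) : ZMod p) = 0 := by
      obtain ⟨c, hc⟩ := Rat.add_den_dvd q r
      rw [hc, Nat.cast_mul, h0, zero_mul]
    rw [Nat.cast_mul] at hd
    exact mul_ne_zero h.1 h'.1 hd
  · rw [Rat.cast_add_of_ne_zero h.1 h'.1, h.2, h'.2]

lemma RedTo.mul {q r : ℚ} {y z : ZMod p} (h : RedTo p q y) (h' : RedTo p r z) :
    RedTo p (q * r) (y * z) := by
  refine ⟨?_, ?_⟩
  · intro h0
    have hd : ((q.den * r.den : ℕ) : ZMod p) = 0 := by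
      obtain ⟨c, hc⟩ := Rat.mul_den_dvd q r
      rw [hc, Nat.cast_mul, h0, zero_mul]
    rw [Nat.cast_mul] at hd
    exact mul_ne_zero h.1 h'.1 hd
  · rw [Rat.cast_mul_of_ne_zero h.1 h'.1, h.2, h'.2]

lemma RedTo.int (n : ℤ) : RedTo p (n : ℚ) (n : ZMod p) := by
  refine ⟨by simp, by simp⟩

lemma RedTo.nat (n : ℕ) : RedTo p (n : ℚ) (n : ZMod p) := by
  refine ⟨by simp, by simp⟩

lemma RedTo.natInv (n : ℕ) (hn : (n : ZMod p) ≠ 0) :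
    RedTo p ((n : ℚ)⁻¹) ((n : ZMod p)⁻¹) := by
  have h0 : n ≠ 0 := by rintro rfl; simp at hn
  have hd : ((n : ℚ)⁻¹).den = n := by
    rw [Rat.inv_natCast_den_of_pos (Nat.pos_of_ne_zero h0)]
  refine ⟨by rwa [hd], ?_⟩
  rw [Rat.cast_inv_of_ne_zero] <;> simp [hn]

lemma RedTo.sum {ι : Type*} (s : Finset ι) (f : ι → ℚ) (g : ι → ZMod p)
    (h : ∀ i ∈ s, RedTo p (f i) (g i)) : RedTo p (∑ i ∈ s, f i) (∑ i ∈ s, g i) := by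
  classical
  induction s using Finset.induction_on with
  | empty => simpa using RedTo.nat (p := p) 0
  | insert a s ha ih =>
    rw [sum_insert ha, sum_insert ha]
    exact (h a (mem_insert_self _ _)).add (ih fun i hi => h i (mem_insert_of_mem hi))

lemma natCast_ne_zero_of_lt {n : ℕ} (h1 : 0 < n) (h2 : n < p) : (n : ZMod p) ≠ 0 := by
  rw [Ne, ZMod.natCast_eq_zero_iff]
  exact Nat.not_dvd_of_pos_of_lt h1 h2

lemma bernoulli'_int (n : ℕ) (hn : n + 1 < p) :
    ∃ z : ZMod p, RedTo p (bernoulli' n) z := by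
  induction n using Nat.strong_induction_on with
  | _ n ih =>
    have ih' : ∀ k, ∃ z : ZMod p, k < n → RedTo p (bernoulli' k) z := by
      intro k
      by_cases hk : k < n
      · obtain ⟨z, hz⟩ := ih k hk (by omega)
        exact ⟨z, fun _ => hz⟩
      · exact ⟨0, fun h => absurd h hk⟩
    choose g hg using ih'
    rw [bernoulli'_def, sub_eq_add_neg, ← neg_one_mul]
    refine ⟨_, RedTo.add (z := (((-1 : ℤ) : ZMod p)) *
      ∑ k ∈ range n, ((n.choose k : ZMod p) * ((n - k + 1 : ℕ) : ZMod p)⁻¹) * g k)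
      (by simpa using RedTo.nat (p := p) 1) ?_⟩
    refine RedTo.mul (by simpa using RedTo.int (p := p) (-1)) (RedTo.sum _ _ _ ?_)
    intro k hk
    rw [mem_range] at hk
    refine RedTo.mul ?_ (hg k hk)
    rw [div_eq_mul_inv]
    refine RedTo.mul (RedTo.nat _) ?_
    have : ((n : ℚ) - k + 1) = ((n - k + 1 : ℕ) : ℚ) := by
      rw [Nat.cast_add, Nat.cast_sub hk.le]; simp
    rw [this]
    exact RedTo.natInv _ (natCast_ne_zero_of_lt (by omega) (by omega))

lemma bernoulli_red (n : ℕ) (hn : n + 1 < p) :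
    RedTo p (bernoulli n) (bernoulliBar p n) := by
  obtain ⟨z, hz⟩ := bernoulli'_int (p := p) n hn
  have h : RedTo p (bernoulli n) (((-1 : ℤ) ^ n : ℤ) * z) := by
    have := (RedTo.int (p := p) ((-1) ^ n)).mul hz
    simpa [bernoulli] using this
  refine ⟨h.1, ?_⟩
  rw [bernoulliBar, Rat.cast_def, div_eq_mul_inv]

/-- Faulhaber mod p. -/
lemma faulhaber_mod (n e : ℕ) (he : e + 1 < p) :
    ∑ k ∈ range n, (k : ZMod p) ^ e = ∑ i ∈ range (e + 1),
      bernoulliBar p i * ((e + 1).choose i : ZMod p) * (n : ZMod p) ^ (e + 1 - i) *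
        ((e + 1 : ℕ) : ZMod p)⁻¹ := by
  have h1 : RedTo p (∑ k ∈ range n, (k : ℚ) ^ e) (∑ k ∈ range n, (k : ZMod p) ^ e) := by
    refine RedTo.sum _ _ _ fun k _ => ?_
    simpa using RedTo.nat (p := p) (k ^ e)
  have h2 : RedTo p (∑ i ∈ range (e + 1),
      bernoulli i * ((e + 1).choose i : ℚ) * (n : ℚ) ^ (e + 1 - i) / ((e : ℚ) + 1))
      (∑ i ∈ range (e + 1),
      bernoulliBar p i * ((e + 1).choose i : ZMod p) * (n : ZMod p) ^ (e + 1 - i) *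
        ((e + 1 : ℕ) : ZMod p)⁻¹) := by
    refine RedTo.sum _ _ _ fun i hi => ?_
    rw [mem_range] at hi
    rw [div_eq_mul_inv]
    refine RedTo.mul (RedTo.mul (RedTo.mul (bernoulli_red i (by omega)) (RedTo.nat _)) ?_) ?_
    · simpa using RedTo.nat (p := p) (n ^ (e + 1 - i))
    · simpa using RedTo.natInv (p := p) (e + 1) (natCast_ne_zero_of_lt (by omega) he)
  rw [sum_range_pow] at h1
  exact h1.2.symm.trans h2.2

lemma sum_Ico_pow_mod (i : ℕ) :
    ∑ m ∈ Ico 1 p, (m : ZMod p) ^ i = if p - 1 ∣ i then -1 else 0 := by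
  have hp : p.Prime := Fact.out
  have h := FiniteField.sum_pow_units (ZMod p) i
  rw [ZMod.card] at h
  rw [← h]
  symm
  refine Finset.sum_bij (fun x _ => (x : ZMod p).val) ?_ ?_ ?_ ?_
  · intro x _
    rw [mem_Ico]
    exact ⟨Nat.pos_of_ne_zero (by simp [ZMod.val_eq_zero]), ZMod.val_lt _⟩
  · intro x _ y _ hxy
    exact Units.ext (ZMod.val_injective p hxy)
  · intro m hm
    rw [mem_Ico] at hm
    refine ⟨Units.mk0 (m : ZMod p) (natCast_ne_zero_of_lt (by omega) hm.2), mem_univ _, ?_⟩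
    simp [ZMod.val_natCast, Nat.mod_eq_of_lt hm.2]
  · intro x _
    simp

/-- The sum `∑_m m^{p-5} H_m` is `B_{p-5}`. -/
lemma sum_harmonic (h5 : 5 < p) :
    ∑ m ∈ Ico 1 p, (m : ZMod p) ^ (p - 5) * ∑ k ∈ Ico 1 (m + 1), (k : ZMod p)⁻¹
      = bernoulliBar p (p - 5) := by
  have hp : p.Prime := Fact.out
  have e1 : ∑ m ∈ Ico 1 p, (m : ZMod p) ^ (p - 5) * ∑ k ∈ Ico 1 (m + 1), (k : ZMod p)⁻¹
      = ∑ k ∈ Ico 1 p, (k : ZMod p)⁻¹ * ∑ m ∈ Ico k p, (m : ZMod p) ^ (p - 5) := by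
    simp_rw [mul_sum]
    rw [Finset.sum_Ico_Ico_comm]
    exact sum_congr rfl fun _ _ => sum_congr rfl fun _ _ => mul_comm _ _
  have hz : ∑ m ∈ range p, (m : ZMod p) ^ (p - 5) = 0 := by
    rw [Finset.range_eq_Ico, Finset.sum_eq_sum_Ico_succ_bot hp.pos, zero_add, sum_Ico_pow_mod,
      if_neg (Nat.not_dvd_of_pos_of_lt (by omega) (by omega))]
    simp; omega
  have e2 : ∀ k ∈ Ico 1 p, (k : ZMod p)⁻¹ * ∑ m ∈ Ico k p, (m : ZMod p) ^ (p - 5)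
      = - ∑ i ∈ range (p - 5 + 1),
      bernoulliBar p i * ((p - 5 + 1).choose i : ZMod p) *
        ((p - 5 + 1 : ℕ) : ZMod p)⁻¹ * (k : ZMod p) ^ (p - 5 - i) := by
    intro k hk
    rw [mem_Ico] at hk
    have hk0 : (k : ZMod p) ≠ 0 := natCast_ne_zero_of_lt (by omega) hk.2
    rw [Finset.sum_Ico_eq_sub _ hk.2.le, hz, zero_sub, mul_neg, faulhaber_mod k (p - 5) (by omega),
      mul_sum]
    congr 1
    refine sum_congr rfl fun i hi => ?_
    rw [mem_range] at hi
    rw [show p - 5 + 1 - i = (p - 5 - i) + 1 by omega, pow_succ]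
    field_simp
  rw [e1, sum_congr rfl e2, sum_neg_distrib, sum_comm]
  simp_rw [← mul_sum, sum_Ico_pow_mod]
  rw [Finset.sum_eq_single (p - 5)]
  · have hne : ((p - 5 + 1 : ℕ) : ZMod p) ≠ 0 := natCast_ne_zero_of_lt (by omega) (by omega)
    rw [Nat.choose_succ_self_right, mul_assoc (bernoulliBar _ _), mul_inv_cancel₀ hne]
    simp
  · intro i hi hi'
    rw [mem_range] at hi
    rw [if_neg (Nat.not_dvd_of_pos_of_lt (by omega) (by omega)), mul_zero]
  · intro h; simp at h

lemma sum_choose_harmonic (m : ℕ) (hm : m < p) :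
    ∑ n ∈ Ico 1 p, (-1 : ZMod p) ^ (n + 1) * (m.choose n : ZMod p) * (n : ZMod p)⁻¹
      = ∑ k ∈ Ico 1 (m + 1), (k : ZMod p)⁻¹ := by
  have hp : p.Prime := Fact.out
  induction m with
  | zero =>
    simp only [zero_add, Ico_self, sum_empty]
    refine sum_eq_zero fun n hn => ?_
    rw [mem_Ico] at hn
    rw [Nat.choose_eq_zero_of_lt (by omega)]; simp
  | succ m ih =>
    rw [Finset.sum_Ico_succ_top (by omega), ← ih (by omega), ← sub_eq_iff_eq_add', ← sum_sub_distrib]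
    have hm0 : ((m + 1 : ℕ) : ZMod p) ≠ 0 := natCast_ne_zero_of_lt (by omega) hm
    have key : ∀ n ∈ Ico 1 p, (-1 : ZMod p) ^ (n + 1) * ((m + 1).choose n : ZMod p) * (n : ZMod p)⁻¹
        - (-1 : ZMod p) ^ (n + 1) * (m.choose n : ZMod p) * (n : ZMod p)⁻¹
        = - ((m + 1 : ℕ) : ZMod p)⁻¹ * ((-1) ^ n * ((m + 1).choose n : ZMod p)) := by
      intro n hn
      rw [mem_Ico] at hn
      have hn0 : (n : ZMod p) ≠ 0 := natCast_ne_zero_of_lt (by omega) hn.2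
      obtain ⟨n, rfl⟩ : ∃ k, n = k + 1 := ⟨n - 1, by omega⟩
      have h1 := congrArg (Nat.cast : ℕ → ZMod p) (Nat.add_one_mul_choose_eq m n)
      have h2 := congrArg (Nat.cast : ℕ → ZMod p) (Nat.choose_succ_succ' m n)
      rw [Nat.cast_mul, Nat.cast_mul] at h1
      rw [Nat.cast_add] at h2
      field_simp
      rw [pow_succ _ (n + 1)]
      linear_combination (-1 : ZMod p) ^ (n + 1) * (- ((m + 1 : ℕ) : ZMod p) * h2 - h1)
    rw [sum_congr rfl key, ← mul_sum]
    have hs : ∑ n ∈ range p, (-1 : ZMod p) ^ n * ((m + 1).choose n : ZMod p) = 0 := by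
      have h := congrArg (Int.cast : ℤ → ZMod p)
        (Int.alternating_sum_range_choose_of_ne (n := m + 1) (by omega))
      push_cast at h
      rw [← Finset.sum_subset (s₁ := range (m + 1 + 1)) _ _, ← h]
      · intro x; simp only [mem_range]; omega
      · intro x _ hx
        simp only [mem_range, not_lt] at hx
        rw [Nat.choose_eq_zero_of_lt (by omega)]; simp
    rw [Finset.range_eq_Ico, Finset.sum_eq_sum_Ico_succ_bot hp.pos, zero_add] at hs
    have hs' : ∑ n ∈ Ico 1 p, (-1 : ZMod p) ^ n * ((m + 1).choose n : ZMod p) = -1 := by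
      simp only [pow_zero, Nat.choose_zero_right, Nat.cast_one, mul_one] at hs
      linear_combination hs
    rw [hs']; ring

open Polynomial in
/-- `∏_{k<n} (1 + X/k)`. -/
noncomputable def zPoly (p : ℕ) [Fact p.Prime] (n : ℕ) : Polynomial (ZMod p) :=
  ∏ k ∈ Ico 1 n, (1 + C ((k : ZMod p)⁻¹) * X)

lemma zPoly_succ {n : ℕ} (hn : 1 ≤ n) : zPoly p (n + 1) =
    zPoly p n * (1 + Polynomial.C ((n : ZMod p)⁻¹) * Polynomial.X) := by
  rw [zPoly, zPoly, Finset.prod_Ico_succ_top hn]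

lemma zPoly_one : zPoly p 1 = 1 := by simp [zPoly]

lemma zPoly_coeff_zero (n : ℕ) : (zPoly p n).coeff 0 = 1 := by
  rw [zPoly, Polynomial.coeff_zero_eq_eval_zero, Polynomial.eval_prod]
  simp

lemma zPoly_coeff_succ (n j : ℕ) (hn : 1 ≤ n) : (zPoly p n).coeff (j + 1) =
    ∑ k ∈ Ico 1 n, (k : ZMod p)⁻¹ * (zPoly p k).coeff j := by
  induction n, hn using Nat.le_induction with
  | base => simp [zPoly_one, Polynomial.coeff_one]
  | succ n hn ih =>
    rw [zPoly_succ hn, Finset.sum_Ico_succ_top hn, ← ih, mul_add, mul_one, Polynomial.coeff_add,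
      ← mul_assoc, Polynomial.coeff_mul_X, Polynomial.coeff_mul_C, mul_comm (n : ZMod p)⁻¹]

lemma zPoly_natDegree (n : ℕ) (hn : 1 ≤ n) : (zPoly p n).natDegree ≤ n - 1 := by
  induction n, hn using Nat.le_induction with
  | base => simp [zPoly_one]
  | succ n hn ih =>
    rw [zPoly_succ hn]
    refine Polynomial.natDegree_mul_le.trans ?_
    have : (1 + Polynomial.C ((n : ZMod p)⁻¹) * Polynomial.X).natDegree ≤ 1 := by
      compute_degree
    omega

lemma zPoly_eval (m n : ℕ) (hn : n < p) :
    (zPoly p (n + 1)).eval (-((m + 1 : ℕ) : ZMod p)) = (-1) ^ n * (m.choose n : ZMod p) := by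
  induction n with
  | zero => simp [zPoly_one]
  | succ n ih =>
    rw [zPoly_succ (by omega), Polynomial.eval_mul, ih (by omega)]
    have hn0 : ((n + 1 : ℕ) : ZMod p) ≠ 0 := natCast_ne_zero_of_lt (by omega) hn
    have h : (m.choose (n + 1) : ZMod p) * ((n + 1 : ℕ) : ZMod p)
        = (m.choose n : ZMod p) * ((m : ZMod p) - n) := by
      have h1 := congrArg (Nat.cast : ℕ → ZMod p) (Nat.choose_succ_right_eq m n)
      rw [Nat.cast_mul, Nat.cast_mul] at h1
      rcases le_or_gt n m with hnm | hnm
      · rw [h1, Nat.cast_sub hnm]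
      · rw [Nat.choose_eq_zero_of_lt hnm, Nat.choose_eq_zero_of_lt (by omega)]; simp
    simp only [Polynomial.eval_add, Polynomial.eval_one, Polynomial.eval_mul, Polynomial.eval_C,
      Polynomial.eval_X]
    field_simp
    rw [pow_succ]
    push_cast at h ⊢
    linear_combination (-1) ^ n * h

/-- `F(X) = ∑ n⁻² ∏_{k<n}(1 + X/k)`. -/
noncomputable def fPoly (p : ℕ) [Fact p.Prime] : Polynomial (ZMod p) :=
  ∑ n ∈ Ico 1 p, Polynomial.C (((n : ZMod p)⁻¹) ^ 2) * zPoly p n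

lemma fPoly_eval (m : ℕ) (h1 : 1 ≤ m) (hm : m < p) :
    (m : ZMod p) * (fPoly p).eval (-(m : ZMod p)) = ∑ k ∈ Ico 1 (m + 1), (k : ZMod p)⁻¹ := by
  rw [← sum_choose_harmonic m hm, fPoly, Polynomial.eval_finsetSum, mul_sum]
  refine sum_congr rfl fun n hn => ?_
  rw [mem_Ico] at hn
  have hn0 : (n : ZMod p) ≠ 0 := natCast_ne_zero_of_lt (by omega) hn.2
  obtain ⟨n, rfl⟩ : ∃ k, n = k + 1 := ⟨n - 1, by omega⟩
  obtain ⟨m, rfl⟩ : ∃ k, m = k + 1 := ⟨m - 1, by omega⟩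
  rw [Polynomial.eval_mul, Polynomial.eval_C, zPoly_eval m n (by omega)]
  have h1 := congrArg (Nat.cast : ℕ → ZMod p) (Nat.add_one_mul_choose_eq m n)
  rw [Nat.cast_mul, Nat.cast_mul] at h1
  field_simp
  rw [pow_succ, pow_succ]
  linear_combination (-1) ^ n * h1

lemma fPoly_natDegree : (fPoly p).natDegree < p - 1 := by
  have hp : p.Prime := Fact.out
  have := hp.two_le
  have : (fPoly p).natDegree ≤ p - 2 := by
    refine Polynomial.natDegree_sum_le_of_forall_le _ _ fun n hn => ?_
    rw [mem_Ico] at hn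
    refine (Polynomial.natDegree_C_mul_le _ _).trans ((zPoly_natDegree n hn.1).trans ?_)
    omega
  omega

lemma fPoly_coeff_three (h5 : 5 < p) :
    (fPoly p).coeff 3 = ∑ m ∈ Ico 1 p, (m : ZMod p) ^ (p - 4) * (fPoly p).eval (-(m : ZMod p)) := by
  have e : ∀ m ∈ Ico 1 p, (m : ZMod p) ^ (p - 4) * (fPoly p).eval (-(m : ZMod p))
      = ∑ j ∈ range (p - 1), (fPoly p).coeff j * (-1) ^ j * (m : ZMod p) ^ (p - 4 + j) := by
    intro m _
    rw [Polynomial.eval_eq_sum_range' fPoly_natDegree, mul_sum]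
    refine sum_congr rfl fun j _ => ?_
    rw [neg_pow, pow_add]; ring
  rw [sum_congr rfl e, sum_comm]
  simp_rw [← mul_sum, sum_Ico_pow_mod]
  rw [Finset.sum_eq_single 3]
  · rw [if_pos (by rw [show p - 4 + 3 = p - 1 by omega])]; ring
  · intro j hj hj'
    rw [mem_range] at hj
    rw [if_neg, mul_zero]
    rintro ⟨c, hc⟩
    rcases c with _ | _ | c
    · omega
    · omega
    · have : (p - 1) * (c + 1 + 1) = (p - 1) * c + 2 * (p - 1) := by ring
      omega
  · intro h; simp only [mem_range] at h; omega

end red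

theorem zeta_1112_eq_bernoulli (p : ℕ) (hp : p.Prime) (h5 : 5 < p) :
    ∑ n4 ∈ Ico 1 p, ∑ n3 ∈ Ico 1 n4, ∑ n2 ∈ Ico 1 n3, ∑ n1 ∈ Ico 1 n2,
      (n1 : ZMod p)⁻¹ * (n2 : ZMod p)⁻¹ * (n3 : ZMod p)⁻¹ * ((n4 : ZMod p)⁻¹) ^ 2
      = bernoulliBar p (p - 5) := by
  have : Fact p.Prime := ⟨hp⟩
  rw [← sum_harmonic h5]
  trans (fPoly p).coeff 3
  · rw [fPoly, Polynomial.finsetSum_coeff]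
    refine sum_congr rfl fun n4 h4 => ?_
    rw [mem_Ico] at h4
    rw [Polynomial.coeff_C_mul, zPoly_coeff_succ _ _ h4.1, mul_sum]
    refine sum_congr rfl fun n3 h3 => ?_
    rw [mem_Ico] at h3
    rw [zPoly_coeff_succ _ _ h3.1, mul_sum, mul_sum]
    refine sum_congr rfl fun n2 h2 => ?_
    rw [mem_Ico] at h2
    rw [zPoly_coeff_succ _ _ h2.1, mul_sum, mul_sum, mul_sum]
    refine sum_congr rfl fun n1 h1 => ?_
    rw [zPoly_coeff_zero]
    ring
  · rw [fPoly_coeff_three h5]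
    refine sum_congr rfl fun m hm => ?_
    rw [mem_Ico] at hm
    rw [← fPoly_eval m hm.1 hm.2, show p - 4 = p - 5 + 1 by omega, pow_succ, mul_assoc]
end
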